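/- arXiv:2406.09616 — 6 statements merged into one kernel-verified Lean document; each statement's English description precedes it below -/
import Mathlib

section
/- Let θ : ℝ × ℝ^d → ℝ^d be a continuously differentiable, compactly supported time-dependent velocity field, let T be its flow, assume T is twice continuously differentiable jointly in (t, X), and fix X ∈ ℝ^d. Let I ⊆ ℝ be an open interval containing 0 on which D_X T_t(X) is invertible, and set Q(t) := (D_X T_t(X))^{-1}. Then Q is differentiable on I and satisfies Q'(t) = −Q(t) ∘ Dθ(t, T(t, X)) for every t ∈ I, where Dθ(t, y) denotes the spatial Fréchet derivative of θ(t, ·) at y. -/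
/-- `Euc d` is the Euclidean space `ℝ^d`. -/
abbrev Euc (d : ℕ) := EuclideanSpace ℝ (Fin d)

/-- The Jacobian of the flow `T` of a velocity field `θ` solves the variational equation
`∂ₜ D_X T_t(X) = Dθ(t, T_t(X)) ∘ D_X T_t(X)`. -/
theorem hasDerivAt_fderiv_of_flow {E : Type*} [NormedAddCommGroup E] [NormedSpace ℝ E]
    {θ : ℝ × E → E} {T : ℝ → E → E} (hθ : Differentiable ℝ θ)
    (hTflow : ∀ t X, HasDerivAt (fun s => T s X) (θ (t, T t X)) t)
    (hT2 : ContDiff ℝ 2 (fun p : ℝ × E => T p.1 p.2)) (t : ℝ) (X : E) :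
    HasDerivAt (fun s => fderiv ℝ (T s) X)
      ((fderiv ℝ (fun y => θ (t, y)) (T t X)).comp (fderiv ℝ (T t) X)) t := by
  set F : ℝ × E → E := fun p => T p.1 p.2
  have hF1 : Differentiable ℝ F := hT2.differentiable (by norm_num)
  have hF2 : Differentiable ℝ (fderiv ℝ F) :=
    (hT2.fderiv_right (m := 1) (by norm_num)).differentiable (by norm_num)
  have hspace (s : ℝ) (Y : E) : HasFDerivAt (fun y : E => (s, y)) (.inr ℝ ℝ E) Y :=
    hasFDerivAt_prodMk_right s Y
  have hT (s : ℝ) (Y : E) : HasFDerivAt (T s) ((fderiv ℝ F (s, Y)).comp (.inr ℝ ℝ E)) Y :=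
    (hF1 (s, Y)).hasFDerivAt.comp Y (hspace s Y)
  have htime (s : ℝ) (Y : E) : HasDerivAt (fun r : ℝ => (r, Y)) ((1 : ℝ), (0 : E)) s :=
    (hasDerivAt_id s).prodMk (hasDerivAt_const s Y)
  have hvel (Y : E) : fderiv ℝ F (t, Y) (1, 0) = θ (t, T t Y) := by
    have h := (hF1 (t, Y)).hasFDerivAt.comp_hasDerivAt t (htime t Y)
    exact h.unique (hTflow t Y)
  have hmixed : HasFDerivAt (fun Y => fderiv ℝ F (t, Y) (1, 0))
      (((fderiv ℝ (fderiv ℝ F) (t, X)).comp (.inr ℝ ℝ E)).flip (1, 0)) X := by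
    simpa using! (((hF2 (t, X)).hasFDerivAt.comp X (hspace t X)).clm_apply
      (hasFDerivAt_const ((1 : ℝ), (0 : E)) X))
  have hchain : HasFDerivAt (fun Y => θ (t, T t Y))
      ((fderiv ℝ (fun y => θ (t, y)) (T t X)).comp (fderiv ℝ (T t) X)) X :=
    ((hθ.comp (by fun_prop : Differentiable ℝ fun y : E => (t, y))) (T t X)).hasFDerivAt.comp X
      (hT t X).differentiableAt.hasFDerivAt
  have hsymm : IsSymmSndFDerivAt ℝ F (t, X) :=
    hT2.contDiffAt.isSymmSndFDerivAt (by simp)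
  have heq := hmixed.unique (by simpa only [hvel] using hchain)
  have hmain : HasDerivAt (fun s => (fderiv ℝ F (s, X)).comp (.inr ℝ ℝ E))
      ((fderiv ℝ (fderiv ℝ F) (t, X) (1, 0)).comp (.inr ℝ ℝ E)) t :=
    (((ContinuousLinearMap.compL ℝ E (ℝ × E) E).flip (.inr ℝ ℝ E)).hasFDerivAt.comp_hasDerivAt t
      ((hF2 (t, X)).hasFDerivAt.comp_hasDerivAt t (htime t X)))
  rw [← heq, funext fun s => (hT s X).fderiv]
  refine hmain.congr_deriv ?_
  ext v
  exact hsymm.eq _ _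

/-- on an open interval `(a, b)` containing `0` on which `D_X T_t(X)` is
invertible, `Q(t) := (D_X T_t(X))⁻¹` is differentiable with
`Q'(t) = −Q(t) ∘ Dθ(t, T(t,X))`. -/
theorem flow_jacobian_inverse_ode {d : ℕ}
    (θ : ℝ × Euc d → Euc d)
    (hθ : ContDiff ℝ 1 θ) (hθc : HasCompactSupport θ)
    (T : ℝ → Euc d → Euc d)
    (hT0 : ∀ X, T 0 X = X)
    (hTflow : ∀ t X, HasDerivAt (fun s => T s X) (θ (t, T t X)) t)
    (hT2 : ContDiff ℝ 2 (fun p : ℝ × Euc d => T p.1 p.2))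
    (X : Euc d)
    (a b : ℝ) (ha : a < 0) (hb : 0 < b)
    (hinv : ∀ t ∈ Set.Ioo a b, IsUnit (fderiv ℝ (T t) X)) :
    ∀ t ∈ Set.Ioo a b,
      HasDerivAt (fun s => (fderiv ℝ (T s) X).inverse)
        (-((fderiv ℝ (T t) X).inverse.comp
            (fderiv ℝ (fun y => θ (t, y)) (T t X)))) t := by
  intro t ht
  obtain ⟨u, hu⟩ := hinv t ht
  have hJ := hasDerivAt_fderiv_of_flow (hθ.differentiable one_ne_zero) hTflow hT2 t X
  have hR := hasFDerivAt_ringInverse (𝕜 := ℝ) u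
  rw [hu] at hR
  have h := hR.comp_hasDerivAt t hJ
  simp only [← ContinuousLinearMap.ringInverse_eq_inverse]
  refine h.congr_deriv ?_
  rw [← hu, Ring.inverse_unit]
  ext v
  have hv : (u : Euc d →L[ℝ] Euc d) ((↑u⁻¹ : Euc d →L[ℝ] Euc d) v) = v :=
    congrArg (fun L : Euc d →L[ℝ] Euc d => L v) u.mul_inv
  simp [hv]
end

section
/- Let θ : ℝ × ℝ^d → ℝ^d be a continuously differentiable, compactly supported time-dependent velocity field, let T be its flow, assume T is twice continuously differentiable jointly in (t, X), and fix X ∈ ℝ^d. Let J_t(X) := det(D_X T_t(X)) denote the Jacobian determinant (the determinant of the matrix of D_X T_t(X) in the standard basis). Then t ↦ J_t(X) is differentiable and satisfies the Liouville formula ∂_t J_t(X) = (div θ)(t, T(t, X)) · J_t(X), where (div θ)(t, y) is the trace of the spatial Fréchet derivative of θ(t, ·) at y. -/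
/-- Jacobi's formula along a linear matrix differential equation: if `M' = L * M` at `t`, then
`(det M)' = tr L * det M` at `t`. -/
theorem HasDerivAt.matrix_det_of_mul {n : Type*} [Fintype n] [DecidableEq n]
    {M : ℝ → Matrix n n ℝ} {L : Matrix n n ℝ} {t : ℝ}
    (hM : ∀ i j, HasDerivAt (fun s => M s i j) ((L * M t) i j) t) :
    HasDerivAt (fun s => (M s).det) (L.trace * (M t).det) t := by
  let D : ContinuousMultilinearMap ℝ (fun _ : n => n → ℝ) ℝ :=
    { (Matrix.detRowAlternating (n := n) (R := ℝ)).toMultilinearMap with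
      cont := Continuous.matrix_det (A := fun M : Matrix n n ℝ => M) continuous_id }
  have hrow : ∀ i, HasFDerivAt (fun s => M s i)
      (ContinuousLinearMap.toSpanSingleton ℝ ((L * M t) i)) t := fun i =>
    (hasDerivAt_pi.2 fun j => hM i j).hasFDerivAt
  have hdet := (HasFDerivAt.multilinear_comp D hrow).hasDerivAt
  refine hdet.congr_deriv ?_
  rw [sum_apply, Matrix.trace, Finset.sum_mul]
  refine Finset.sum_congr rfl fun i _ => ?_
  have hLi : (L * M t) i = ∑ j, L i j • M t j := by
    ext k
    simp [Matrix.mul_apply]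
  have hupdate : ((M t).updateRow i ((L * M t) i)).det = L i i * (M t).det := by
    rw [hLi, Matrix.det_updateRow_sum, smul_eq_mul]
  simp only [ContinuousLinearMap.comp_apply, ContinuousLinearMap.toSpanSingleton_apply, one_smul,
    ContinuousMultilinearMap.toContinuousLinearMap_apply]
  exact hupdate

/-- The spatial derivative of a `C²` flow solves the linearized equation. -/
theorem hasDerivAt_fderiv_flow_apply {E : Type*} [NormedAddCommGroup E] [NormedSpace ℝ E]
    {θ : ℝ × E → E} (hθ : Differentiable ℝ θ) {T : ℝ → E → E}
    (hTflow : ∀ t X, HasDerivAt (fun s => T s X) (θ (t, T t X)) t)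
    (hT2 : ContDiff ℝ 2 (fun p : ℝ × E => T p.1 p.2)) (t : ℝ) (X v : E) :
    HasDerivAt (fun s => fderiv ℝ (T s) X v)
      (fderiv ℝ (fun y => θ (t, y)) (T t X) (fderiv ℝ (T t) X v)) t := by
  set F : ℝ × E → E := fun p => T p.1 p.2
  have hFd : Differentiable ℝ F := hT2.differentiable (by norm_num)
  have hF'd : Differentiable ℝ (fderiv ℝ F) :=
    (hT2.fderiv_right (m := 1) (by norm_num)).differentiable (by norm_num)
  have hspace : ∀ s v, fderiv ℝ (T s) X v = fderiv ℝ F (s, X) (0, v) := fun s v => by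
    have h := (hFd (s, X)).hasFDerivAt.comp X (hasFDerivAt_prodMk_right (𝕜 := ℝ) s X)
    have h' : HasFDerivAt (T s) _ X := h
    rw [h'.fderiv]
    simp
  have htime : ∀ p : ℝ × E, fderiv ℝ F p (1, 0) = θ (p.1, F p) := fun p => by
    have h := (hFd (p.1, p.2)).hasFDerivAt.comp_hasDerivAt p.1
      ((hasDerivAt_id p.1).prodMk (hasDerivAt_const p.1 p.2))
    exact h.unique (hTflow p.1 p.2)
  have hderiv : HasDerivAt (fun s => fderiv ℝ F (s, X) (0, v))
      (fderiv ℝ (fderiv ℝ F) (t, X) (1, 0) (0, v)) t := by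
    have h := (hF'd (t, X)).hasFDerivAt.comp_hasDerivAt t
      ((hasDerivAt_id t).prodMk (hasDerivAt_const t X))
    simpa using h.clm_apply (hasDerivAt_const t ((0, v) : ℝ × E))
  have hsymm : fderiv ℝ (fderiv ℝ F) (t, X) (1, 0) (0, v)
      = fderiv ℝ (fderiv ℝ F) (t, X) (0, v) (1, 0) :=
    (hT2.contDiffAt.isSymmSndFDerivAt (by simp)).eq _ _
  have hmixed : fderiv ℝ (fderiv ℝ F) (t, X) (0, v) (1, 0)
      = fderiv ℝ θ (t, T t X) (0, fderiv ℝ F (t, X) (0, v)) := by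
    have h₁ := (hF'd (t, X)).hasFDerivAt.clm_apply (hasFDerivAt_const ((1, 0) : ℝ × E) (t, X))
    have h₂ := (hθ (t, T t X)).hasFDerivAt.comp (t, X)
      (hasFDerivAt_fst.prodMk (hFd (t, X)).hasFDerivAt)
    have h := (h₁.congr_of_eventuallyEq
      (Filter.Eventually.of_forall fun p => (htime p).symm)).unique h₂
    simpa using DFunLike.congr_fun h (0, v)
  have hθspace : ∀ w, fderiv ℝ (fun y => θ (t, y)) (T t X) w
      = fderiv ℝ θ (t, T t X) (0, w) := fun w => by
    have h : HasFDerivAt (fun y => θ (t, y)) _ (T t X) := (hθ (t, T t X)).hasFDerivAt.comp (T t X)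
      (hasFDerivAt_prodMk_right (𝕜 := ℝ) t (T t X))
    rw [h.fderiv]
    simp
  simp only [hspace, hθspace]
  rwa [hsymm, hmixed] at hderiv

/-- Liouville formula for the Jacobian determinant of the flow:
`∂_t det(D_X T_t(X)) = (div θ)(t, T(t,X)) · det(D_X T_t(X))`. -/
theorem flow_jacobian_det_liouville {d : ℕ}
    (θ : ℝ × Euc d → Euc d)
    (hθ : ContDiff ℝ 1 θ) (hθc : HasCompactSupport θ)
    (T : ℝ → Euc d → Euc d)
    (hT0 : ∀ X, T 0 X = X)
    (hTflow : ∀ t X, HasDerivAt (fun s => T s X) (θ (t, T t X)) t)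
    (hT2 : ContDiff ℝ 2 (fun p : ℝ × Euc d => T p.1 p.2)) :
    ∀ (t : ℝ) (X : Euc d),
      HasDerivAt (fun s => LinearMap.det ((fderiv ℝ (T s) X).toLinearMap))
        ((LinearMap.trace ℝ (Euc d) ((fderiv ℝ (fun y => θ (t, y)) (T t X)).toLinearMap)) *
          LinearMap.det ((fderiv ℝ (T t) X).toLinearMap)) t := by
  intro t X
  let b := (EuclideanSpace.basisFun (Fin d) ℝ).toBasis
  have hθd : Differentiable ℝ θ := hθ.differentiable (by norm_num)
  simp only [← LinearMap.det_toMatrix b, LinearMap.trace_eq_matrix_trace ℝ b]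
  refine HasDerivAt.matrix_det_of_mul fun i j => ?_
  rw [← LinearMap.toMatrix_comp b b b, LinearMap.toMatrix_apply]
  simp only [LinearMap.toMatrix_apply]
  have h := hasDerivAt_fderiv_flow_apply hθd hTflow hT2 t X (b j)
  simpa [b, Function.comp_def] using (EuclideanSpace.proj (𝕜 := ℝ) i).hasFDerivAt.comp_hasDerivAt t h
end

section
/- Let P : ℝ → Matrix (Fin d) (Fin d) ℝ be differentiable at 0 with P(0) = Id (the identity matrix) and P'(0) = B. Then the map t ↦ det(P(t)) · P(t)⁻¹ · (P(t)⁻¹)^T is differentiable at t = 0 with derivative (trace B) · Id − B − B^T. -/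
namespace Matrix

section LinftyOp

attribute [local instance] Matrix.linftyOpNormedRing Matrix.linftyOpNormedAlgebra

variable {n : Type*} [Fintype n] [DecidableEq n]

theorem differentiable_det : Differentiable ℝ (det : Matrix n n ℝ → ℝ) := by
  have entry (i j : n) : Differentiable ℝ (fun M : Matrix n n ℝ => M i j) :=
    (entryLinearMap ℝ ℝ i j).toContinuousLinearMap.differentiable
  simp only [funext det_apply']
  fun_prop

theorem hasDerivAt_det_one_add_smul (B : Matrix n n ℝ) :
    HasDerivAt (fun t : ℝ => (1 + t • B).det) B.trace 0 := by
  have h := (Polynomial.hasDerivAt (det (1 + (Polynomial.X : Polynomial ℝ) • B.map Polynomial.C)) 0)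
  rw [derivative_det_one_add_X_smul] at h
  convert! h using 2 with t
  simp [eval_det, ← smul_eq_mul_diagonal]

theorem fderiv_det_one (B : Matrix n n ℝ) :
    fderiv ℝ (det : Matrix n n ℝ → ℝ) 1 B = B.trace := by
  have hline : HasDerivAt (fun t : ℝ => 1 + t • B) B 0 := by
    simpa only [one_smul, id_eq] using! ((hasDerivAt_id (0 : ℝ)).smul_const B).const_add 1
  have hdet : HasFDerivAt (det : Matrix n n ℝ → ℝ) (fderiv ℝ det 1) (1 + (0 : ℝ) • B) := by
    simpa using (differentiable_det 1).hasFDerivAt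
  exact (hdet.comp_hasDerivAt 0 hline).unique (hasDerivAt_det_one_add_smul B)

variable {P : ℝ → Matrix n n ℝ} {B : Matrix n n ℝ} {x : ℝ}

theorem hasDerivAt_det_of_eq_one (hP : HasDerivAt P B x) (hx : P x = 1) :
    HasDerivAt (fun t => (P t).det) B.trace x := by
  have hdet : HasFDerivAt (det : Matrix n n ℝ → ℝ) (fderiv ℝ det 1) (P x) := by
    simpa [hx] using (differentiable_det 1).hasFDerivAt
  rw [← fderiv_det_one]
  exact hdet.comp_hasDerivAt x hP

theorem hasDerivAt_inv_of_eq_one (hP : HasDerivAt P B x) (hx : P x = 1) :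
    HasDerivAt (fun t => (P t)⁻¹) (-B) x := by
  have hinv : HasFDerivAt Ring.inverse
      (-ContinuousLinearMap.mulLeftRight ℝ (Matrix n n ℝ) 1 1) (P x) := by
    simpa [hx] using hasFDerivAt_ringInverse (𝕜 := ℝ) (1 : (Matrix n n ℝ)ˣ)
  simpa [nonsing_inv_eq_ringInverse, Function.comp_def] using! hinv.comp_hasDerivAt x hP

theorem hasDerivAt_transpose (hP : HasDerivAt P B x) :
    HasDerivAt (fun t => (P t)ᵀ) Bᵀ x :=
  (transposeLinearEquiv n n ℝ ℝ).toLinearMap.toContinuousLinearMap.hasFDerivAt.comp_hasDerivAt x hP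

theorem hasDerivAt_det_smul_inv_mul_transpose_inv (hP : HasDerivAt P B x) (hx : P x = 1) :
    HasDerivAt (fun t => (P t).det • ((P t)⁻¹ * ((P t)⁻¹)ᵀ))
      (B.trace • (1 : Matrix n n ℝ) - B - Bᵀ) x := by
  have hinv := hasDerivAt_inv_of_eq_one hP hx
  convert! (hasDerivAt_det_of_eq_one hP hx).smul (hinv.mul (hasDerivAt_transpose hinv)) using 1
  simp [hx]
  abel

end LinftyOp

end Matrix

/-- if `P : ℝ → Matrix (Fin d) (Fin d) ℝ` is differentiable at `0` with
`P 0 = 1` and `P' 0 = B`, then `t ↦ det(P t) • (P t)⁻¹ * ((P t)⁻¹)ᵀ` is differentiable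
at `t = 0` with derivative `(trace B) • 1 − B − Bᵀ`. -/
theorem shape_matrix_deriv_at_zero {d : ℕ}
    (P : ℝ → Matrix (Fin d) (Fin d) ℝ)
    (B : Matrix (Fin d) (Fin d) ℝ)
    (hP : HasDerivAt P B 0)
    (hP0 : P 0 = 1) :
    HasDerivAt (fun t => (P t).det • ((P t)⁻¹ * ((P t)⁻¹).transpose))
      (B.trace • (1 : Matrix (Fin d) (Fin d) ℝ) - B - B.transpose) 0 := by
  exact Matrix.hasDerivAt_det_smul_inv_mul_transpose_inv hP hP0
end

section
/- Let Φ : ℝ^d → ℝ^d be a C¹ diffeomorphism (Φ is bijective, Φ and Φ⁻¹ are continuously differentiable), let Ω ⊆ ℝ^d be a bounded measurable set, and let w, f, g : ℝ^d → ℝ be continuously differentiable with compact support. Then ∫_{Φ(Ω)} (w ∘ Φ⁻¹)(y) ⟨∇(f ∘ Φ⁻¹)(y), ∇(g ∘ Φ⁻¹)(y)⟩ dy = ∫_Ω w(x) |det DΦ(x)| ⟨(DΦ(x))⁻¹ (DΦ(x))⁻ᵀ ∇f(x), ∇g(x)⟩ dx, where DΦ(x) is the Fréchet derivative of Φ at x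 (identified with its matrix in the standard basis), ∇ denotes the gradient, and ⟨·,·⟩ the Euclidean inner product on ℝ^d. -/
open MeasureTheory
open scoped RealInnerProductSpace

/-- The gradient of a composition is the adjoint of the inner derivative applied to the outer
gradient. -/
theorem gradient_comp_eq_adjoint_fderiv {E F : Type*}
    [NormedAddCommGroup E] [InnerProductSpace ℝ E] [CompleteSpace E]
    [NormedAddCommGroup F] [InnerProductSpace ℝ F] [CompleteSpace F]
    {f : F → ℝ} {Ψ : E → F} {y : E}
    (hf : DifferentiableAt ℝ f (Ψ y)) (hΨ : DifferentiableAt ℝ Ψ y) :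
    gradient (f ∘ Ψ) y = ContinuousLinearMap.adjoint (fderiv ℝ Ψ y) (gradient f (Ψ y)) := by
  refine ext_inner_right ℝ fun v => ?_
  rw [ContinuousLinearMap.adjoint_inner_left, gradient, gradient,
    InnerProductSpace.toDual_symm_apply, InnerProductSpace.toDual_symm_apply,
    fderiv_comp y hf hΨ, ContinuousLinearMap.comp_apply]

/-- The derivative of a differentiable two-sided inverse is the inverse of the derivative. -/
theorem inverse_fderiv_eq_fderiv_of_inverse {E F : Type*}
    [NormedAddCommGroup E] [NormedSpace ℝ E] [NormedAddCommGroup F] [NormedSpace ℝ F]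
    {Φ : E → F} {Ψ : F → E} (hΦ : Differentiable ℝ Φ) (hΨ : Differentiable ℝ Ψ)
    (hleft : Function.LeftInverse Ψ Φ) (hright : Function.RightInverse Ψ Φ) (x : E) :
    (fderiv ℝ Φ x).inverse = fderiv ℝ Ψ (Φ x) := by
  apply ContinuousLinearMap.inverse_eq
  · have h := fderiv_comp (Φ x) (hΦ (Ψ (Φ x))) (hΨ (Φ x))
    rw [hright.comp_eq_id, fderiv_id, hleft x] at h
    exact h.symm
  · have h := fderiv_comp x (hΨ (Φ x)) (hΦ x)
    rw [hleft.comp_eq_id, fderiv_id] at h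
    exact h.symm

/-- pullback identity for the weighted Dirichlet form under a C¹ diffeomorphism
`Φ` with inverse `Ψ`:
`∫_{Φ(Ω)} (w∘Ψ) ⟨∇(f∘Ψ), ∇(g∘Ψ)⟩ = ∫_Ω w |det DΦ| ⟨(DΦ)⁻¹(DΦ)⁻ᵀ ∇f, ∇g⟩`. -/
theorem dirichlet_form_pullback {d : ℕ}
    (Φ Ψ : Euc d → Euc d)
    (hΦbij : Function.Bijective Φ)
    (hΦ : ContDiff ℝ 1 Φ) (hΨ : ContDiff ℝ 1 Ψ)
    (hleft : Function.LeftInverse Ψ Φ) (hright : Function.RightInverse Ψ Φ)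
    (Ω : Set (Euc d)) (hΩb : Bornology.IsBounded Ω) (hΩm : MeasurableSet Ω)
    (w f g : Euc d → ℝ)
    (hw : ContDiff ℝ 1 w) (hwc : HasCompactSupport w)
    (hf : ContDiff ℝ 1 f) (hfc : HasCompactSupport f)
    (hg : ContDiff ℝ 1 g) (hgc : HasCompactSupport g) :
    (∫ y in Φ '' Ω, w (Ψ y) * ⟪gradient (f ∘ Ψ) y, gradient (g ∘ Ψ) y⟫) =
      ∫ x in Ω, w x * |LinearMap.det ((fderiv ℝ Φ x).toLinearMap)| *
        ⟪((fderiv ℝ Φ x).inverse.comp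
            (ContinuousLinearMap.adjoint ((fderiv ℝ Φ x).inverse)))
          (gradient f x), gradient g x⟫ := by
  have hΦd := hΦ.differentiable one_ne_zero
  have hΨd := hΨ.differentiable one_ne_zero
  rw [integral_image_eq_integral_abs_det_fderiv_smul volume hΩm
    (fun x _ => (hΦd x).hasFDerivAt.hasFDerivWithinAt) hΦbij.injective.injOn]
  refine integral_congr_ae (.of_forall fun x => ?_)
  simp only
  rw [gradient_comp_eq_adjoint_fderiv (hf.differentiable one_ne_zero _) (hΨd _),
    gradient_comp_eq_adjoint_fderiv (hg.differentiable one_ne_zero _) (hΨd _),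
    inverse_fderiv_eq_fderiv_of_inverse hΦd hΨd hleft hright, hleft x,
    ContinuousLinearMap.adjoint_inner_right, ContinuousLinearMap.comp_apply,
    ContinuousLinearMap.det, smul_eq_mul]
  ring
end

section
/- Let θ : ℝ × ℝ^d → ℝ^d be a continuously differentiable, compactly supported time-dependent velocity field, let T be its flow, and assume T is twice continuously differentiable jointly in (t, X). Let Ω ⊆ ℝ^d be a bounded measurable set and let F : ℝ × ℝ^d → ℝ be continuously differentiable with compact support. Then the map t ↦ ∫_{T_t(Ω)} F(t, x) dx is differentiable at t = 0 with derivative ∫_Ω [∂_t F(0, x) + div_x(F(0, ·) θ(0, ·))(x)] dx, where div_x(F(0,·)θ(0,·)) = ∇_x F(0,·) · θ(0,·) + F(0,·) (div θ)(0,·) and integrals are with respect to d-dimensional Lebesgue measure. -/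
open MeasureTheory
open scoped RealInnerProductSpace

theorem HasFDerivAt.hasDerivAt_prodMk_left {E F : Type*} [NormedAddCommGroup E] [NormedSpace ℝ E]
    [NormedAddCommGroup F] [NormedSpace ℝ F] {f : ℝ × E → F} {f' : ℝ × E →L[ℝ] F} {t : ℝ} {x : E}
    (hf : HasFDerivAt f f' (t, x)) : HasDerivAt (fun s => f (s, x)) (f' (1, 0)) t :=
  hf.comp_hasDerivAt (f := fun s : ℝ => (s, x)) t
    ((hasDerivAt_id t).prodMk (hasDerivAt_const t x))

theorem HasFDerivAt.hasFDerivAt_prodMk_right {E F : Type*} [NormedAddCommGroup E]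
    [NormedSpace ℝ E] [NormedAddCommGroup F] [NormedSpace ℝ F] {f : ℝ × E → F}
    {f' : ℝ × E →L[ℝ] F} {t : ℝ} {x : E} (hf : HasFDerivAt f f' (t, x)) :
    HasFDerivAt (fun y => f (t, y)) (f'.comp (ContinuousLinearMap.inr ℝ ℝ E)) x :=
  hf.comp x (_root_.hasFDerivAt_prodMk_right t x)

section Determinant

variable {E : Type*} [NormedAddCommGroup E] [NormedSpace ℝ E] [FiniteDimensional ℝ E]

theorem ContinuousLinearMap.contDiff_det {n : WithTop ℕ∞} :
    ContDiff ℝ n (fun A : E →L[ℝ] E => A.det) := by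
  let b := Module.finBasis ℝ E
  have hentry (i j) : ContDiff ℝ n
      (fun A : E →L[ℝ] E => LinearMap.toMatrix b b (A : E →ₗ[ℝ] E) i j) := by
    simp only [LinearMap.toMatrix_apply]
    exact (LinearMap.toContinuousLinearMap (b.coord i)).contDiff.comp
      (ContinuousLinearMap.apply ℝ E (b j)).contDiff
  have hdet : (fun A : E →L[ℝ] E => A.det) =
      fun A : E →L[ℝ] E => (LinearMap.toMatrix b b (A : E →ₗ[ℝ] E)).det := by
    ext A
    exact (LinearMap.det_toMatrix b _).symm
  rw [hdet]
  simp only [Matrix.det_apply, Units.smul_def, zsmul_eq_mul]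
  exact ContDiff.sum fun σ _ => contDiff_const.mul (contDiff_prod fun i _ => hentry _ _)

theorem ContinuousLinearMap.hasDerivAt_det_id_add_smul (M : E →L[ℝ] E) :
    HasDerivAt (fun r : ℝ => (ContinuousLinearMap.id ℝ E + r • M).det)
      (LinearMap.trace ℝ E M) 0 := by
  let b := Module.finBasis ℝ E
  set N := LinearMap.toMatrix b b (M : E →ₗ[ℝ] E) with hN
  have hdet (r : ℝ) : (ContinuousLinearMap.id ℝ E + r • M).det = (1 + r • N).det := by
    rw [ContinuousLinearMap.det, ← LinearMap.det_toMatrix b]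
    simp [hN]
  simp only [fun r => (hdet r).trans (Matrix.det_one_add_smul r N),
    LinearMap.trace_eq_matrix_trace ℝ b, ← hN]
  have h := (((hasDerivAt_id (0 : ℝ)).const_mul N.trace).const_add 1).add
    (((Polynomial.hasDerivAt
      ((1 + (Polynomial.X : Polynomial ℝ) • N.map Polynomial.C).det.divX.divX) 0)).mul
      ((hasDerivAt_id (0 : ℝ)).pow 2))
  simpa using! h

theorem HasDerivAt.clm_det_of_eq_id {A : ℝ → E →L[ℝ] E} {M : E →L[ℝ] E} {t : ℝ}
    (hA : HasDerivAt A M t) (hid : A t = ContinuousLinearMap.id ℝ E) :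
    HasDerivAt (fun s => (A s).det) (LinearMap.trace ℝ E M) t := by
  have hd : DifferentiableAt ℝ (fun B : E →L[ℝ] E => B.det) (ContinuousLinearMap.id ℝ E) :=
    (ContinuousLinearMap.contDiff_det (n := 1)).differentiable one_ne_zero _
  have hline : HasDerivAt (fun r : ℝ => ContinuousLinearMap.id ℝ E + r • M) M 0 := by
    simpa using ((hasDerivAt_id (0 : ℝ)).smul_const M).const_add (ContinuousLinearMap.id ℝ E)
  have hline' := HasFDerivAt.comp_hasDerivAt (x := (0 : ℝ))
    (l := fun B : E →L[ℝ] E => B.det)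
    (f := fun r : ℝ => ContinuousLinearMap.id ℝ E + r • M) (by simpa using hd.hasFDerivAt) hline
  rw [← hline'.unique (ContinuousLinearMap.hasDerivAt_det_id_add_smul M)]
  exact HasFDerivAt.comp_hasDerivAt (l := fun B : E →L[ℝ] E => B.det) t
    (by rw [hid]; exact hd.hasFDerivAt) hA

end Determinant

theorem hasDerivAt_setIntegral_of_contDiff {E : Type*} [NormedAddCommGroup E] [NormedSpace ℝ E]
    [ProperSpace E] [MeasurableSpace E] [BorelSpace E] {μ : Measure E}
    [IsFiniteMeasureOnCompacts μ] {Ω : Set E} (hΩ : Bornology.IsBounded Ω)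
    (hΩm : MeasurableSet Ω) {G : ℝ × E → ℝ} (hG : ContDiff ℝ 1 G) (t₀ : ℝ) :
    HasDerivAt (fun t => ∫ x in Ω, G (t, x) ∂μ)
      (∫ x in Ω, deriv (fun s => G (s, x)) t₀ ∂μ) t₀ := by
  have hK : IsCompact (closure Ω) := hΩ.isCompact_closure
  have hderiv (t : ℝ) (x : E) :
      HasDerivAt (fun s => G (s, x)) (fderiv ℝ G (t, x) (1, 0)) t :=
    (hG.differentiable one_ne_zero (t, x)).hasFDerivAt.hasDerivAt_prodMk_left
  have hcont : Continuous fun p : ℝ × E => fderiv ℝ G p (1, 0) :=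
    (hG.continuous_fderiv one_ne_zero).clm_apply continuous_const
  obtain ⟨C, hC⟩ := ((isCompact_closedBall t₀ 1).prod hK).exists_bound_of_continuousOn
    hcont.continuousOn
  have hfin : IsFiniteMeasure (μ.restrict Ω) :=
    ⟨by simpa using (measure_mono subset_closure).trans_lt hK.measure_lt_top⟩
  have hslice (t : ℝ) : Continuous fun x => G (t, x) := hG.continuous.comp (by fun_prop)
  simp only [fun x => (hderiv t₀ x).deriv]
  refine (hasDerivAt_integral_of_dominated_loc_of_deriv_le (bound := fun _ => C)
    (F' := fun t x => fderiv ℝ G (t, x) (1, 0))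
    (Metric.closedBall_mem_nhds t₀ one_pos)
    (.of_forall fun t => (hslice t).aestronglyMeasurable) ?_
    (hcont.comp (by fun_prop : Continuous fun x => (t₀, x))).aestronglyMeasurable
    ?_ (integrable_const C) (.of_forall fun x t _ => hderiv t x)).2
  · exact ((hslice t₀).continuousOn.integrableOn_compact hK).mono_set subset_closure
  · filter_upwards [ae_restrict_mem hΩm] with x hx t ht
    exact hC (t, x) ⟨ht, subset_closure hx⟩

section Flow

variable {E : Type*} [NormedAddCommGroup E] [NormedSpace ℝ E]

theorem injective_of_lipschitz_flow {θ : ℝ × E → E} {K : NNReal} (hθ : LipschitzWith K θ)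
    {T : ℝ → E → E} (hT0 : ∀ X, T 0 X = X)
    (hT : ∀ t X, HasDerivAt (fun s => T s X) (θ (t, T t X)) t) (t : ℝ) :
    Function.Injective (T t) := by
  intro X Y hXY
  have h : (fun s => T s X) = fun s => T s Y :=
    ODE_solution_unique_univ (K := K) (v := fun s x => θ (s, x)) (s := fun _ => Set.univ)
      (t₀ := t) (fun s => ?_) (fun s => ⟨hT s X, trivial⟩) (fun s => ⟨hT s Y, trivial⟩) hXY
  · simpa [hT0] using congrFun h 0
  · have := hθ.comp (LipschitzWith.prodMk_left s)
    rw [mul_one] at this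
    exact this.lipschitzOnWith

theorem hasFDerivAt_slice_of_contDiff {T : ℝ → E → E}
    (hT2 : ContDiff ℝ 2 (fun p : ℝ × E => T p.1 p.2)) (t : ℝ) (X : E) :
    HasFDerivAt (T t)
      ((fderiv ℝ (fun p : ℝ × E => T p.1 p.2) (t, X)).comp (ContinuousLinearMap.inr ℝ ℝ E)) X :=
  (hT2.differentiable two_ne_zero (t, X)).hasFDerivAt.hasFDerivAt_prodMk_right

theorem contDiff_fderiv_slice {T : ℝ → E → E}
    (hT2 : ContDiff ℝ 2 (fun p : ℝ × E => T p.1 p.2)) :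
    ContDiff ℝ 1 (fun p : ℝ × E => fderiv ℝ (T p.1) p.2) := by
  simp only [fun t X => (hasFDerivAt_slice_of_contDiff hT2 t X).fderiv]
  exact (hT2.fderiv_right (m := 1) (by norm_num)).clm_comp contDiff_const

/-- The spatial derivative of a flow satisfies the linearized equation at time `0`. -/
theorem hasDerivAt_fderiv_flow {T : ℝ → E → E}
    (hT2 : ContDiff ℝ 2 (fun p : ℝ × E => T p.1 p.2)) {θ : ℝ × E → E} (hT0 : ∀ X, T 0 X = X)
    (hT : ∀ t X, HasDerivAt (fun s => T s X) (θ (t, T t X)) t) (X : E) :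
    HasDerivAt (fun s => fderiv ℝ (T s) X) (fderiv ℝ (fun y => θ (0, y)) X) 0 := by
  set f : ℝ × E → E := fun p => T p.1 p.2 with hf
  have hf' : Differentiable ℝ (fderiv ℝ f) :=
    (hT2.fderiv_right (m := 1) (by norm_num)).differentiable one_ne_zero
  have hsymm : IsSymmSndFDerivAt ℝ f (0, X) := hT2.contDiffAt.isSymmSndFDerivAt (by simp)
  have htime (Y : E) : fderiv ℝ f (0, Y) (1, 0) = θ (0, Y) := by
    have h := (hT2.differentiable two_ne_zero (0, Y)).hasFDerivAt.hasDerivAt_prodMk_left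
    simpa [hT0] using h.unique (hT 0 Y)
  have hθ : fderiv ℝ (fun y => θ (0, y)) X =
      ((fderiv ℝ (fderiv ℝ f) (0, X)).comp (ContinuousLinearMap.inr ℝ ℝ E)).flip (1, 0) := by
    have h := (hf' (0, X)).hasFDerivAt.hasFDerivAt_prodMk_right.clm_apply
      (hasFDerivAt_const ((1, 0) : ℝ × E) X)
    simp only [htime] at h
    rw [h.fderiv]
    ext v
    simp
  have hA := (hf' (0, X)).hasFDerivAt.hasDerivAt_prodMk_left.clm_comp
    (hasDerivAt_const (0 : ℝ) (ContinuousLinearMap.inr ℝ ℝ E))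
  simp only [fun t => (hasFDerivAt_slice_of_contDiff hT2 t X).fderiv]
  refine hA.congr_deriv ?_
  rw [hθ]
  ext v
  simpa using hsymm (1, 0) (0, v)

end Flow

/-- Hadamard's formula in domain form: `t ↦ ∫_{T_t(Ω)} F(t, x) dx` is
differentiable at `t = 0` with derivative
`∫_Ω (∂_t F(0,x) + ∇_x F(0,x)·θ(0,x) + F(0,x)(div θ)(0,x)) dx`. -/
theorem hadamard_domain_formula {d : ℕ}
    (θ : ℝ × Euc d → Euc d)
    (hθ : ContDiff ℝ 1 θ) (hθc : HasCompactSupport θ)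
    (T : ℝ → Euc d → Euc d)
    (hT0 : ∀ X, T 0 X = X)
    (hTflow : ∀ t X, HasDerivAt (fun s => T s X) (θ (t, T t X)) t)
    (hT2 : ContDiff ℝ 2 (fun p : ℝ × Euc d => T p.1 p.2))
    (Ω : Set (Euc d)) (hΩb : Bornology.IsBounded Ω) (hΩm : MeasurableSet Ω)
    (F : ℝ × Euc d → ℝ)
    (hF : ContDiff ℝ 1 F) (hFc : HasCompactSupport F) :
    HasDerivAt (fun t => ∫ x in T t '' Ω, F (t, x))
      (∫ x in Ω, (deriv (fun s => F (s, x)) 0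
        + (⟪gradient (fun y => F (0, y)) x, θ (0, x)⟫
          + F (0, x) * LinearMap.trace ℝ (Euc d) ((fderiv ℝ (fun y => θ (0, y)) x).toLinearMap))))
      0 := by
  have hJ : ContDiff ℝ 1 (fun p : ℝ × Euc d => (fderiv ℝ (T p.1) p.2).det) :=
    ContinuousLinearMap.contDiff_det.comp (contDiff_fderiv_slice hT2)
  have hFT : ContDiff ℝ 1 (fun p : ℝ × Euc d => F (p.1, T p.1 p.2)) :=
    hF.comp (contDiff_fst.prodMk (hT2.of_le one_le_two))
  have hid (X : Euc d) : fderiv ℝ (T 0) X = ContinuousLinearMap.id ℝ (Euc d) := by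
    rw [show T 0 = id from funext hT0, fderiv_id]
  have hpos : ∀ᶠ t in nhds (0 : ℝ), ∀ X ∈ closure Ω, 0 < (fderiv ℝ (T t) X).det := by
    refine hΩb.isCompact_closure.eventually_forall_of_forall_eventually fun X _ => ?_
    exact hJ.continuous.continuousAt.eventually_const_lt (by simp [hid, ContinuousLinearMap.det])
  obtain ⟨K, hK⟩ := hθ.lipschitzWith_of_hasCompactSupport hθc one_ne_zero
  have hchange : (fun t => ∫ x in T t '' Ω, F (t, x)) =ᶠ[nhds 0]
      fun t => ∫ X in Ω, (fderiv ℝ (T t) X).det * F (t, T t X) := by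
    filter_upwards [hpos] with t ht
    rw [integral_image_eq_integral_abs_det_fderiv_smul volume hΩm
      (fun X _ =>
        (hasFDerivAt_slice_of_contDiff hT2 t X).differentiableAt.hasFDerivAt.hasFDerivWithinAt)
      (injective_of_lipschitz_flow hK hT0 hTflow t).injOn]
    refine setIntegral_congr_fun hΩm fun X hX => ?_
    simp only [abs_of_pos (ht X (subset_closure hX)), smul_eq_mul]
  refine ((hasDerivAt_setIntegral_of_contDiff hΩb hΩm (hJ.mul hFT) 0).congr_of_eventuallyEq
    hchange).congr_deriv ?_
  refine setIntegral_congr_fun hΩm fun X _ => ?_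
  have hFd := (hF.differentiable one_ne_zero (0, X)).hasFDerivAt
  have htime : HasDerivAt (fun s => F (s, X)) (fderiv ℝ F (0, X) (1, 0)) 0 :=
    hFd.hasDerivAt_prodMk_left
  have hspace : HasFDerivAt (fun y => F (0, y))
      ((fderiv ℝ F (0, X)).comp (ContinuousLinearMap.inr ℝ ℝ (Euc d))) X :=
    hFd.hasFDerivAt_prodMk_right
  have hmat : HasDerivAt (fun s => F (s, T s X)) (fderiv ℝ F (0, X) (1, θ (0, X))) 0 := by
    have hcurve := (hasDerivAt_id (0 : ℝ)).prodMk (hTflow 0 X)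
    rw [hT0] at hcurve
    exact HasFDerivAt.comp_hasDerivAt (l := F) (0 : ℝ) (by simpa [hT0] using hFd) hcurve
  have hdet := (hasDerivAt_fderiv_flow hT2 hT0 hTflow X).clm_det_of_eq_id (hid X)
  have hgrad : ⟪gradient (fun y => F (0, y)) X, θ (0, X)⟫ = fderiv ℝ F (0, X) (0, θ (0, X)) := by
    rw [gradient, InnerProductSpace.toDual_symm_apply, hspace.fderiv]
    simp
  have hsplit : fderiv ℝ F (0, X) (1, θ (0, X)) =
      fderiv ℝ F (0, X) (1, 0) + fderiv ℝ F (0, X) (0, θ (0, X)) := by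
    rw [← map_add]
    simp
  refine (hdet.mul hmat).deriv.trans ?_
  simp only [htime.deriv, hgrad, hsplit, hid, hT0]
  simp only [ContinuousLinearMap.det, ContinuousLinearMap.coe_id, LinearMap.det_id]
  ring
end

section
/- Let θ : ℝ × ℝ^d → ℝ^d be a continuously differentiable, compactly supported time-dependent velocity field, let T be its flow, and assume T is twice continuously differentiable jointly in (t, X). Let Ω ⊆ ℝ^d be a bounded measurable set, let w, f, g : ℝ^d → ℝ be continuously differentiable with compact support, and for small t set A(t, x) := det(D_X T_t(x)) (D_X T_t(x))⁻¹ (D_X T_t(x))⁻ᵀ (well defined for t near 0 since D_X T_0(x) = Id). Then the map t ↦ ∫_Ω w(x) ⟨A(t, x) ∇f(x), ∇g(x)⟩ dx is differentiable at t = 0 with derivative ∫_Ω w(x) ⟨M(θ)(x) ∇f(x), ∇g(x)⟩ dx, where M(θ)(x) := (div θ)(0, x) Id − Dθ(0, x) − Dθ(0, x)^T, Dθ(0, x) being the spatial Fréchet derivative of θ(0, ·) at x and (div θ)(0, x) its trace. -/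
open MeasureTheory
open scoped RealInnerProductSpace

/-- The shape-calculus matrix `A(t, x) = J_t(x) (D_X T_t(x))⁻¹ (D_X T_t(x))⁻ᵀ`,
as a continuous linear map on `ℝ^d`. -/
noncomputable def shapeMatrixA {d : ℕ} (T : ℝ → Euc d → Euc d) (t : ℝ) (x : Euc d) :
    Euc d →L[ℝ] Euc d :=
  LinearMap.det ((fderiv ℝ (T t) x).toLinearMap) •
    ((fderiv ℝ (T t) x).inverse.comp
      (ContinuousLinearMap.adjoint ((fderiv ℝ (T t) x).inverse)))

/-- The matrix `M(θ)(x) = (div θ)(0, x) Id − Dθ(0, x) − Dθ(0, x)ᵀ`. -/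
noncomputable def shapeMatrixM {d : ℕ} (θ : ℝ × Euc d → Euc d) (x : Euc d) :
    Euc d →L[ℝ] Euc d :=
  (LinearMap.trace ℝ (Euc d) ((fderiv ℝ (fun y => θ (0, y)) x).toLinearMap)) •
      ContinuousLinearMap.id ℝ (Euc d)
    - fderiv ℝ (fun y => θ (0, y)) x
    - ContinuousLinearMap.adjoint (fderiv ℝ (fun y => θ (0, y)) x)

/-- Differentiation under the integral sign over a subset of a compact set, for an integrand
that is jointly continuous together with its `t`-derivative. -/
theorem hasDerivAt_integral_of_continuousOn_of_isCompact {X : Type*} [TopologicalSpace X]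
    [T2Space X] [MeasurableSpace X] [OpensMeasurableSpace X] {μ : Measure X}
    [IsFiniteMeasureOnCompacts μ] {K s : Set X} (hK : IsCompact K) (hsK : s ⊆ K)
    {U : Set (ℝ × X)} (hU : IsOpen U) {a : ℝ} (hKU : ∀ x ∈ K, (a, x) ∈ U)
    {G G' : ℝ × X → ℝ} (hG : ContinuousOn G U) (hG' : ContinuousOn G' U)
    (hd : ∀ p ∈ U, HasDerivAt (fun t => G (t, p.2)) (G' p) p.1) :
    HasDerivAt (fun t => ∫ x in s, G (t, x) ∂μ) (∫ x in s, G' (a, x) ∂μ) a := by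
  obtain ⟨u, v, hu, -, hau, hKv, huv⟩ := generalized_tube_lemma (isCompact_singleton (x := a)) hK hU
    (by rintro ⟨t, x⟩ ⟨rfl, hx⟩; exact hKU x hx)
  obtain ⟨ε, hε, hεu⟩ := Metric.nhds_basis_closedBall.mem_iff.1 (hu.mem_nhds (hau rfl))
  have hsub : Metric.closedBall a ε ×ˢ K ⊆ U := (Set.prod_mono hεu hKv).trans huv
  obtain ⟨C, hC⟩ :=
    ((isCompact_closedBall a ε).prod hK).exists_bound_of_continuousOn (hG'.mono hsub)
  have hslice : ∀ {H : ℝ × X → ℝ}, ContinuousOn H U → ∀ t ∈ Metric.closedBall a ε,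
      IntegrableOn (fun x => H (t, x)) s μ := fun {H} hH t ht =>
    ((hH.comp (f := fun x => (t, x)) (by fun_prop) fun x hx => hsub ⟨ht, hx⟩).integrableOn_compact
      hK).mono_set hsK
  have ha : a ∈ Metric.closedBall a ε := Metric.mem_closedBall_self hε.le
  have hball : Metric.closedBall a ε ∈ nhds a := Metric.closedBall_mem_nhds a hε
  have haes : ∀ᵐ x ∂μ.restrict s, x ∈ K :=
    ae_mono (Measure.restrict_mono hsK le_rfl) (ae_restrict_mem hK.measurableSet)
  refine (hasDerivAt_integral_of_dominated_loc_of_deriv_le (F := fun t x => G (t, x))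
    (F' := fun t x => G' (t, x)) (bound := fun _ => C) hball ?_ (hslice hG a ha)
    (hslice hG' a ha).aestronglyMeasurable ?_ ?_ ?_).2
  · filter_upwards [hball] with t ht using (hslice hG t ht).aestronglyMeasurable
  · filter_upwards [haes] with x hx t ht using hC (t, x) ⟨ht, hx⟩
  · exact (continuousOn_const.integrableOn_compact hK).mono_set hsK
  · filter_upwards [haes] with x hx t ht using hd (t, x) (hsub ⟨ht, hx⟩)

section Det

variable {E : Type*} [NormedAddCommGroup E] [NormedSpace ℝ E] [FiniteDimensional ℝ E]

theorem contDiff_continuousLinearMap_det {n : WithTop ℕ∞} :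
    ContDiff ℝ n (fun L : E →L[ℝ] E => LinearMap.det L.toLinearMap) := by
  let b := Module.finBasis ℝ E
  have h : (fun L : E →L[ℝ] E => LinearMap.det L.toLinearMap) = fun L : E →L[ℝ] E =>
      ∑ σ : Equiv.Perm (Fin (Module.finrank ℝ E)), ((Equiv.Perm.sign σ : ℤ) : ℝ) *
        ∏ i, b.repr (L (b i)) (σ i) := by
    ext L
    rw [← LinearMap.det_toMatrix b, Matrix.det_apply']
    simp [LinearMap.toMatrix_apply]
  rw [h]
  refine ContDiff.sum fun σ _ => contDiff_const.mul (contDiff_prod fun i _ => ?_)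
  exact (LinearMap.toContinuousLinearMap ((b.coord (σ i)) ∘ₗ
    (ContinuousLinearMap.apply ℝ E (b i)).toLinearMap)).contDiff

theorem hasFDerivAt_det_id :
    HasFDerivAt (fun L : E →L[ℝ] E => LinearMap.det L.toLinearMap)
      (LinearMap.toContinuousLinearMap
        (LinearMap.trace ℝ E ∘ₗ ContinuousLinearMap.coeLM ℝ)) (ContinuousLinearMap.id ℝ E) := by
  have h := ((contDiff_continuousLinearMap_det (E := E) (n := 1)).differentiable
    one_ne_zero (ContinuousLinearMap.id ℝ E)).hasFDerivAt
  convert! h using 1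
  ext L
  let b := Module.finBasis ℝ E
  have hline : HasDerivAt (fun r : ℝ => ContinuousLinearMap.id ℝ E + r • L) L 0 := by
    simpa using ((hasDerivAt_id (0 : ℝ)).smul_const L).const_add (ContinuousLinearMap.id ℝ E)
  have h1 := HasFDerivAt.comp_hasDerivAt (l := fun L : E →L[ℝ] E => LinearMap.det L.toLinearMap)
    (f := fun r : ℝ => ContinuousLinearMap.id ℝ E + r • L) (0 : ℝ)
    (by rw [zero_smul, add_zero]; exact h) hline
  refine HasDerivAt.unique ?_ h1
  have h2 : (fun L : E →L[ℝ] E => LinearMap.det L.toLinearMap) ∘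
      (fun r : ℝ => ContinuousLinearMap.id ℝ E + r • L) =
      fun r : ℝ => 1 + (LinearMap.toMatrix b b L.toLinearMap).trace * r +
        (Matrix.det (1 + (Polynomial.X : Polynomial ℝ) •
          (LinearMap.toMatrix b b L.toLinearMap).map Polynomial.C)).divX.divX.eval r * r ^ 2 := by
    ext r
    rw [← Matrix.det_one_add_smul, Function.comp_apply, ← LinearMap.det_toMatrix b]
    simp
  rw [h2, LinearMap.coe_toContinuousLinearMap', LinearMap.comp_apply, ContinuousLinearMap.coeLM_apply,
    LinearMap.trace_eq_matrix_trace ℝ b]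
  set p := (Matrix.det (1 + (Polynomial.X : Polynomial ℝ) •
    (LinearMap.toMatrix b b L.toLinearMap).map Polynomial.C)).divX.divX
  have h3 := (((hasDerivAt_id (0 : ℝ)).const_mul
    (LinearMap.toMatrix b b L.toLinearMap).trace).const_add 1).add
    ((p.hasDerivAt 0).mul ((hasDerivAt_id (0 : ℝ)).pow 2))
  refine h3.congr_deriv ?_
  simp

end Det

section Pullback

variable {E : Type*} [NormedAddCommGroup E] [InnerProductSpace ℝ E] [FiniteDimensional ℝ E]

/-- The adjoint on a real inner product space, as a continuous linear map. -/
noncomputable def realAdjointCLM : (E →L[ℝ] E) →L[ℝ] (E →L[ℝ] E) where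
  toFun L := ContinuousLinearMap.adjoint L
  map_add' := by simp
  map_smul' := by simp
  cont := ContinuousLinearMap.adjoint.continuous

theorem realAdjointCLM_apply (L : E →L[ℝ] E) :
    realAdjointCLM L = ContinuousLinearMap.adjoint L := rfl

/-- The map `L ↦ det L • L⁻¹ L⁻ᵀ`. -/
noncomputable def detInvMulInvAdjoint (L : E →L[ℝ] E) : E →L[ℝ] E :=
  LinearMap.det L.toLinearMap • (L.inverse.comp (ContinuousLinearMap.adjoint L.inverse))

theorem contDiffAt_detInvMulInvAdjoint {n : WithTop ℕ∞} {L : E →L[ℝ] E} (hL : L.IsInvertible) :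
    ContDiffAt ℝ n detInvMulInvAdjoint L := by
  have hi : ContDiffAt ℝ n ContinuousLinearMap.inverse L := hL.contDiffAt_map_inverse
  exact contDiff_continuousLinearMap_det.contDiffAt.smul
    (hi.clm_comp ((realAdjointCLM (E := E)).contDiff.contDiffAt.comp L hi))

theorem hasFDerivAt_inverse_id :
    HasFDerivAt (ContinuousLinearMap.inverse : (E →L[ℝ] E) → E →L[ℝ] E)
      (-ContinuousLinearMap.id ℝ (E →L[ℝ] E)) (ContinuousLinearMap.id ℝ E) := by
  have h := hasFDerivAt_ringInverse (𝕜 := ℝ) (1 : (E →L[ℝ] E)ˣ)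
  rw [ContinuousLinearMap.ringInverse_eq_inverse] at h
  convert! h using 1

theorem hasDerivAt_detInvMulInvAdjoint {L : ℝ → E →L[ℝ] E} {L' : E →L[ℝ] E} {t : ℝ}
    (hL : HasDerivAt L L' t) (ht : L t = ContinuousLinearMap.id ℝ E) :
    HasDerivAt (fun s => detInvMulInvAdjoint (L s))
      (LinearMap.trace ℝ E L'.toLinearMap • ContinuousLinearMap.id ℝ E - L'
        - ContinuousLinearMap.adjoint L') t := by
  have hdet := (ht ▸ hasFDerivAt_det_id (E := E)).comp_hasDerivAt t hL
  have hinv := (ht ▸ hasFDerivAt_inverse_id (E := E)).comp_hasDerivAt t hL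
  have hadj := realAdjointCLM.hasFDerivAt.comp_hasDerivAt t hinv
  have h := hdet.smul (hinv.clm_comp hadj)
  refine h.congr_deriv ?_
  simp only [Function.comp_apply, ht, realAdjointCLM_apply, ContinuousLinearMap.inverse_id,
    ContinuousLinearMap.adjoint_id]
  simp
  abel

end Pullback

section Flow

variable {E : Type*} [NormedAddCommGroup E] [NormedSpace ℝ E]

theorem fderiv_slice_eq {T : ℝ → E → E}
    (hT : Differentiable ℝ (fun p : ℝ × E => T p.1 p.2)) (t : ℝ) (x : E) :
    fderiv ℝ (T t) x = (fderiv ℝ (fun p : ℝ × E => T p.1 p.2) (t, x)).comp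
      (ContinuousLinearMap.inr ℝ ℝ E) :=
  ((hT (t, x)).hasFDerivAt.comp x (hasFDerivAt_prodMk_right t x)).fderiv

/-- The linearised flow equation at time zero: `∂_t D_X T_t(x) = Dθ(0, x)` at `t = 0`. -/
theorem hasDerivAt_fderiv_flow_zero {θ : ℝ × E → E} {T : ℝ → E → E} (hT0 : ∀ X, T 0 X = X)
    (hTflow : ∀ t X, HasDerivAt (fun s => T s X) (θ (t, T t X)) t)
    (hT2 : ContDiff ℝ 2 (fun p : ℝ × E => T p.1 p.2)) (x : E) :
    HasDerivAt (fun t => fderiv ℝ (T t) x) (fderiv ℝ (fun y => θ (0, y)) x) 0 := by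
  set F := fun p : ℝ × E => T p.1 p.2 with hF
  have hdF : Differentiable ℝ F := hT2.differentiable two_ne_zero
  have hd2 : DifferentiableAt ℝ (fderiv ℝ F) (0, x) :=
    (hT2.fderiv_right (m := 1) (by norm_num)).differentiable one_ne_zero _
  have hsymm : IsSymmSndFDerivAt ℝ F (0, x) := hT2.contDiffAt.isSymmSndFDerivAt (by simp)
  have htime : ∀ y, θ (0, y) = fderiv ℝ F (0, y) (1, 0) := fun y => by
    have h := (hdF (0, y)).hasFDerivAt.comp_hasDerivAt (0 : ℝ)
      ((hasDerivAt_id (0 : ℝ)).prodMk (hasDerivAt_const (0 : ℝ) y))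
    have h' := hTflow 0 y
    rw [hT0] at h'
    exact h'.unique h
  have hθ : fderiv ℝ (fun y => θ (0, y)) x = ((ContinuousLinearMap.apply ℝ E ((1 : ℝ), (0 : E))).comp
      (fderiv ℝ (fderiv ℝ F) (0, x))).comp (ContinuousLinearMap.inr ℝ ℝ E) := by
    simp_rw [htime]
    exact ((ContinuousLinearMap.apply ℝ E ((1 : ℝ), (0 : E))).hasFDerivAt.comp x
      (hd2.hasFDerivAt.comp x (hasFDerivAt_prodMk_right (0 : ℝ) x))).fderiv
  simp_rw [fderiv_slice_eq hdF]
  have h := hd2.hasFDerivAt.comp_hasDerivAt (0 : ℝ)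
      ((hasDerivAt_id (0 : ℝ)).prodMk (hasDerivAt_const (0 : ℝ) x))
  have h2 := h.clm_comp (hasDerivAt_const (0 : ℝ) (ContinuousLinearMap.inr ℝ ℝ E))
  refine h2.congr_deriv ?_
  rw [hθ]
  ext v
  simpa using hsymm (1, 0) (0, v)

end Flow

/-- `t ↦ ∫_Ω w ⟨A(t,·)∇f, ∇g⟩` is differentiable at `t = 0` with derivative
`∫_Ω w ⟨M(θ)∇f, ∇g⟩`. -/
theorem dirichlet_form_shape_derivative {d : ℕ}
    (θ : ℝ × Euc d → Euc d)
    (hθ : ContDiff ℝ 1 θ) (hθc : HasCompactSupport θ)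
    (T : ℝ → Euc d → Euc d)
    (hT0 : ∀ X, T 0 X = X)
    (hTflow : ∀ t X, HasDerivAt (fun s => T s X) (θ (t, T t X)) t)
    (hT2 : ContDiff ℝ 2 (fun p : ℝ × Euc d => T p.1 p.2))
    (Ω : Set (Euc d)) (hΩb : Bornology.IsBounded Ω) (hΩm : MeasurableSet Ω)
    (w f g : Euc d → ℝ)
    (hw : ContDiff ℝ 1 w) (hwc : HasCompactSupport w)
    (hf : ContDiff ℝ 1 f) (hfc : HasCompactSupport f)
    (hg : ContDiff ℝ 1 g) (hgc : HasCompactSupport g) :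
    HasDerivAt (fun t => ∫ x in Ω, w x * ⟪shapeMatrixA T t x (gradient f x), gradient g x⟫)
      (∫ x in Ω, w x * ⟪shapeMatrixM θ x (gradient f x), gradient g x⟫) 0 := by
  have hdF : Differentiable ℝ (fun p : ℝ × Euc d => T p.1 p.2) := hT2.differentiable two_ne_zero
  have hid : ∀ x, fderiv ℝ (T 0) x = ContinuousLinearMap.id ℝ (Euc d) := fun x => by
    rw [show T 0 = id from funext hT0, fderiv_id]
  let D : ℝ × Euc d → (Euc d →L[ℝ] Euc d) := fun p => fderiv ℝ (T p.1) p.2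
  have hD : ContDiff ℝ 1 D := by
    have h : D = fun p => (fderiv ℝ (fun p : ℝ × Euc d => T p.1 p.2) p).comp
      (ContinuousLinearMap.inr ℝ ℝ (Euc d)) := funext fun p => fderiv_slice_eq hdF p.1 p.2
    rw [h]
    exact (hT2.fderiv_right (by norm_num)).clm_comp contDiff_const
  let U : Set (ℝ × Euc d) := D ⁻¹' {L | L.IsInvertible}
  have hU : IsOpen U := ContinuousLinearEquiv.isOpen.preimage hD.continuous
  let A : ℝ × Euc d → (Euc d →L[ℝ] Euc d) := fun p => shapeMatrixA T p.1 p.2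
  have hA : ContDiffOn ℝ 1 A U := fun p hp =>
    ((contDiffAt_detInvMulInvAdjoint hp).comp p hD.contDiffAt).contDiffWithinAt
  have hdA : ∀ p ∈ U, HasDerivAt (fun t => A (t, p.2)) (fderiv ℝ A p (1, 0)) p.1 := fun p hp =>
    HasFDerivAt.comp_hasDerivAt (f := fun t => (t, p.2)) p.1
      ((hA.differentiableOn one_ne_zero).differentiableAt (hU.mem_nhds hp)).hasFDerivAt
      ((hasDerivAt_id p.1).prodMk (hasDerivAt_const p.1 p.2))
  have hcA' : ContinuousOn (fun p => fderiv ℝ A p (1, 0)) U :=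
    (hA.continuousOn_fderiv_of_isOpen hU le_rfl).clm_apply continuousOn_const
  have hU0 : ∀ x, ((0 : ℝ), x) ∈ U := fun x => by
    change (fderiv ℝ (T 0) x).IsInvertible
    rw [hid]
    exact ⟨ContinuousLinearEquiv.refl ℝ _, rfl⟩
  have hM : ∀ x, shapeMatrixM θ x = fderiv ℝ A (0, x) (1, 0) := fun x =>
    (hasDerivAt_detInvMulInvAdjoint (hasDerivAt_fderiv_flow_zero hT0 hTflow hT2 x) (hid x)).unique
      (hdA (0, x) (hU0 x))
  have hgrad : ∀ {h : Euc d → ℝ}, ContDiff ℝ 1 h → Continuous (gradient h) := fun {h} hh =>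
    (InnerProductSpace.toDual ℝ (Euc d)).symm.continuous.comp (hh.continuous_fderiv one_ne_zero)
  have hcont : ∀ {B : ℝ × Euc d → (Euc d →L[ℝ] Euc d)}, ContinuousOn B U →
      ContinuousOn (fun p => w p.2 * ⟪B p (gradient f p.2), gradient g p.2⟫) U := fun hB =>
    (hw.continuous.comp continuous_snd).continuousOn.mul
      ((hB.clm_apply ((hgrad hf).comp continuous_snd).continuousOn).inner
        ((hgrad hg).comp continuous_snd).continuousOn)
  simp_rw [hM]
  refine hasDerivAt_integral_of_continuousOn_of_isCompact hΩb.isCompact_closure subset_closure hU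
    (fun x _ => hU0 x) (hcont hA.continuousOn) (hcont hcA') fun p hp => ?_
  have h := (((hdA p hp).clm_apply (hasDerivAt_const p.1 (gradient f p.2))).inner ℝ
    (hasDerivAt_const p.1 (gradient g p.2))).const_mul (w p.2)
  simpa using h
end
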